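/- arXiv:2011.08143 — 2 statements merged into one kernel-verified Lean document; each statement's English description precedes it below -/
import Mathlib

section
/- Let q, m, n ∈ ℤ with m, n > 0 and gcd(q,m) = 1, let u ∈ ℤ^{n-1}, and let C ∈ GL_{n-1}(ℤ) be a matrix of order m. Then the block matrices A = [[1, 0ᵀ],[u, C]] and Ā = [[1, 0ᵀ],[u, C^q]] are conjugate in GL_n(ℚ). -/
open Matrix

noncomputable section

/-- The block matrix `[[1, 0ᵀ],[u, C]]`. -/
def blockOne {k : ℕ} (u : Fin k → ℤ) (C : Matrix (Fin k) (Fin k) ℤ) :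
    Matrix (Fin (k+1)) (Fin (k+1)) ℤ :=
  Matrix.of fun i j =>
    Fin.cases (Fin.cases 1 (fun _ => 0) j) (fun i' => Fin.cases (u i') (fun j' => C i' j') j) i

/-- Cast an integer matrix to a rational matrix. -/
def QMat {k : ℕ} (M : Matrix (Fin k) (Fin k) ℤ) : Matrix (Fin k) (Fin k) ℚ :=
  M.map (Int.cast)

section

open Polynomial

theorem minpoly_pow_eq_of_coprime {K : Type*} [CommRing K] [alg : Algebra ℚ K] (hK : IsField K)
    {ζ : K} {m r : ℕ} (hm : 0 < m) (hr : r.Coprime m) (hζ : ζ ^ m = 1) :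
    minpoly ℚ (ζ ^ r) = minpoly ℚ ζ := by
  let _ : Field K := hK.toField
  have _ : CharZero K := algebraRat.charZero K
  obtain rfl : alg = DivisionRing.toRatAlgebra := Subsingleton.elim _ _
  have hd : 0 < orderOf ζ := orderOf_pos_iff.2 (isOfFinOrder_iff_pow_eq_one.2 ⟨m, hm, hζ⟩)
  have h := IsPrimitiveRoot.orderOf ζ
  have h' := h.pow_of_coprime r (hr.coprime_dvd_right (orderOf_dvd_of_pow_eq_one hζ))
  exact (Polynomial.cyclotomic_eq_minpoly_rat h' hd).symm.trans
    (Polynomial.cyclotomic_eq_minpoly_rat h hd)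

theorem exists_injective_twist_of_isSimpleModule {S : Type*} [AddCommGroup S] [Module ℚ S]
    [Module ℚ[X] S] [IsScalarTower ℚ ℚ[X] S] [IsSimpleModule ℚ[X] S] {m r : ℕ} (hm : 0 < m)
    (hr : r.Coprime m) (hS : ∀ x : S, (X ^ m : ℚ[X]) • x = x) :
    ∃ P : S →ₗ[ℚ] S, Function.Injective P ∧
      (∀ x, P ((X : ℚ[X]) • x) = (X ^ r : ℚ[X]) • P x) ∧
      ∀ x, (X : ℚ[X]) • x = x → P x = x := by
  obtain ⟨I, hI, ⟨e⟩⟩ := isSimpleModule_iff_quot_maximal.1 ‹IsSimpleModule ℚ[X] S›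
  have hK : IsField (ℚ[X] ⧸ I) := Ideal.Quotient.maximal_ideal_iff_isField_quotient I |>.1 hI
  have : IsSimpleRing (ℚ[X] ⧸ I) := isSimpleRing_iff_isField _ |>.2 hK
  let π : ℚ[X] →ₐ[ℚ] ℚ[X] ⧸ I := Ideal.Quotient.mkₐ ℚ I
  have hsmul (p : ℚ[X]) (y : ℚ[X] ⧸ I) : p • y = π p * y := by
    obtain ⟨y, rfl⟩ := Ideal.Quotient.mk_surjective y
    rfl
  have hζ : π X ^ m = 1 := by
    have := congrArg e (hS (e.symm 1))
    simpa [hsmul] using this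
  have hπ (p : ℚ[X]) : aeval (π X) p = π p := by
    rw [aeval_algHom_apply, aeval_X_left_apply]
  have hker (p : ℚ[X]) (hp : π p = 0) : aeval (π X ^ r) p = 0 := by
    rw [← minpoly.dvd_iff, minpoly_pow_eq_of_coprime hK hm hr hζ, minpoly.dvd_iff, hπ, hp]
  let σ : ℚ[X] ⧸ I →ₐ[ℚ] ℚ[X] ⧸ I :=
    Ideal.Quotient.liftₐ I (aeval (π X ^ r)) fun p hp =>
      hker p (Ideal.Quotient.eq_zero_iff_mem.2 hp)
  have hσ (p : ℚ[X]) : σ (π p) = aeval (π X ^ r) p := rfl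
  let f := e.restrictScalars ℚ
  refine ⟨f.symm.toLinearMap ∘ₗ σ.toLinearMap ∘ₗ f.toLinearMap,
    f.symm.injective.comp (σ.toRingHom.injective.comp f.injective), fun x => ?_, fun x hx => ?_⟩
  · apply e.injective
    change e (e.symm (σ (e _))) = e (_ • e.symm (σ (e x)))
    simp [hsmul, hσ]
  · apply e.injective
    change e (e.symm (σ (e x))) = e x
    rw [e.apply_symm_apply]
    by_cases h0 : e x = 0
    · rw [h0, map_zero]
    have h1 : π X = 1 := by
      have := congrArg e hx
      rw [map_smul, hsmul] at this
      exact mul_right_cancel₀ h0 (this.trans (one_mul _).symm)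
    obtain ⟨p, hp⟩ := Ideal.Quotient.mk_surjective (e x)
    rw [← hp]
    change σ (π p) = π p
    rw [hσ, h1, one_pow, ← h1, hπ]

theorem exists_injective_twist_of_isSemisimpleModule {M : Type*} [AddCommGroup M] [Module ℚ M]
    [Module ℚ[X] M] [IsScalarTower ℚ ℚ[X] M] [IsSemisimpleModule ℚ[X] M] {m r : ℕ} (hm : 0 < m)
    (hr : r.Coprime m) (hM : ∀ x : M, (X ^ m : ℚ[X]) • x = x) :
    ∃ P : M →ₗ[ℚ] M, Function.Injective P ∧
      (∀ x, P ((X : ℚ[X]) • x) = (X ^ r : ℚ[X]) • P x) ∧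
      ∀ x, (X : ℚ[X]) • x = x → P x = x := by
  obtain ⟨s, e, -, hs⟩ := IsSemisimpleModule.exists_linearEquiv_dfinsupp ℚ[X] M
  have key (i : s) := exists_injective_twist_of_isSimpleModule (S := i.1) hm hr
    fun x => Subtype.ext (hM x)
  choose Q hQ hQX hQ1 using key
  let f := e.restrictScalars ℚ
  refine ⟨f.symm.toLinearMap ∘ₗ DFinsupp.mapRange.linearMap Q ∘ₗ f.toLinearMap,
    f.symm.injective.comp (((DFinsupp.mapRange_injective _ fun i => map_zero (Q i)).2 hQ).comp
      f.injective), fun x => ?_, fun x hx => ?_⟩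
  · apply e.injective
    change e (e.symm (DFinsupp.mapRange.linearMap Q (e _))) =
      e (_ • e.symm (DFinsupp.mapRange.linearMap Q (e x)))
    rw [e.map_smul, e.map_smul, e.apply_symm_apply, e.apply_symm_apply]
    ext1 i
    exact hQX i _
  · apply e.injective
    change e (e.symm (DFinsupp.mapRange.linearMap Q (e x))) = e x
    rw [e.apply_symm_apply]
    ext1 i
    refine hQ1 i _ ?_
    rw [← DFinsupp.smul_apply, ← map_smul, hx]

theorem exists_twist_of_pow_eq_one {V : Type*} [AddCommGroup V] [Module ℚ V]
    [FiniteDimensional ℚ V] (f : Module.End ℚ V) {m r : ℕ} (hm : 0 < m) (hr : r.Coprime m)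
    (hf : f ^ m = 1) :
    ∃ P : V ≃ₗ[ℚ] V, (∀ x, P (f x) = (f ^ r) (P x)) ∧ ∀ x, f x = x → P x = x := by
  have hsq : Squarefree (X ^ m - C 1 : ℚ[X]) :=
    (separable_X_pow_sub_C 1 (by exact_mod_cast hm.ne') one_ne_zero).squarefree
  have : IsSemisimpleModule ℚ[X] (Module.AEval' f) :=
    Module.End.isSemisimple_of_squarefree_aeval_eq_zero hsq (by simp [hf])
  let o : V ≃ₗ[ℚ] Module.AEval' f := Module.AEval'.of f
  have ho (p : ℚ[X]) (x : V) : p • o x = o (aeval f p x) := rfl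
  obtain ⟨P, hP, hPX, hP1⟩ := exists_injective_twist_of_isSemisimpleModule
    (M := Module.AEval' f) hm hr fun x => by
      obtain ⟨x, rfl⟩ := o.surjective x
      simp [ho, hf]
  refine ⟨LinearEquiv.ofInjectiveEndo (o.symm.toLinearMap ∘ₗ P ∘ₗ o.toLinearMap)
    (o.symm.injective.comp (hP.comp o.injective)), fun x => ?_, fun x hx => ?_⟩
  · have h := hPX (o x)
    rw [ho, aeval_X] at h
    have h2 := ho (X ^ r) (o.symm (P (o x)))
    rw [o.apply_symm_apply, map_pow, aeval_X] at h2
    change o.symm (P (o (f x))) = (f ^ r) (o.symm (P (o x)))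
    rw [h, h2, o.symm_apply_apply]
  · change o.symm (P (o x)) = x
    rw [hP1, o.symm_apply_apply]
    rw [ho, aeval_X, hx]

theorem exists_fixed_add_of_pow_eq_one {V : Type*} [AddCommGroup V] [Module ℚ V]
    (f : Module.End ℚ V) {m : ℕ} (hm : 0 < m) (hf : f ^ m = 1) (u : V) :
    ∃ u₀ w, f u₀ = u₀ ∧ u = u₀ + (f w - w) := by
  have hm' : (m : ℚ) ≠ 0 := by exact_mod_cast hm.ne'
  have hrange (i : ℕ) : ∃ w, u = (f ^ i) u + (f w - w) := by
    refine ⟨-(∑ j ∈ Finset.range i, f ^ j) u, ?_⟩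
    have h := LinearMap.congr_fun (mul_geom_sum f i) u
    simp only [Module.End.mul_apply, LinearMap.sub_apply, Module.End.one_apply] at h
    rw [map_neg, sub_neg_eq_add, ← sub_eq_neg_add]
    rw [← neg_sub, h]
    abel
  choose w hw using hrange
  refine ⟨(m : ℚ)⁻¹ • ∑ i ∈ Finset.range m, (f ^ i) u,
    (m : ℚ)⁻¹ • ∑ i ∈ Finset.range m, w i, ?_, ?_⟩
  · have h := LinearMap.congr_fun (mul_geom_sum f m) u
    rw [hf, sub_self] at h
    simp only [Module.End.mul_apply, LinearMap.sub_apply, Module.End.one_apply,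
      LinearMap.zero_apply, sub_eq_zero, LinearMap.sum_apply] at h
    rw [map_smul, h]
  · rw [map_smul, ← smul_sub, ← smul_add, map_sum, ← Finset.sum_sub_distrib,
      ← Finset.sum_add_distrib, Finset.sum_congr rfl fun i _ => (hw i).symm]
    simp [← Nat.cast_smul_eq_nsmul ℚ, smul_smul, hm']

theorem exists_affine_conjugator {V : Type*} [AddCommGroup V] [Module ℚ V]
    [FiniteDimensional ℚ V] (f : Module.End ℚ V) {m r : ℕ} (hm : 0 < m) (hr : r.Coprime m)
    (hf : orderOf f = m) (u : V) :
    ∃ (P : V ≃ₗ[ℚ] V) (b : V), (∀ x, P (f x) = (f ^ r) (P x)) ∧ b + P u = u + (f ^ r) b := by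
  have hf1 : f ^ m = 1 := hf ▸ pow_orderOf_eq_one f
  obtain ⟨P, hP, hP1⟩ := exists_twist_of_pow_eq_one f hm hr hf1
  obtain ⟨u₀, w, hu₀, rfl⟩ := exists_fixed_add_of_pow_eq_one f hm hf1 u
  obtain ⟨s, hs⟩ := exists_pow_eq_self_of_coprime (hf.symm ▸ hr : r.Coprime (orderOf f))
  have h := LinearMap.congr_fun (mul_geom_sum (f ^ r) s) w
  rw [hs] at h
  simp only [Module.End.mul_apply, LinearMap.sub_apply, Module.End.one_apply] at h
  refine ⟨P, P w - (∑ i ∈ Finset.range s, (f ^ r) ^ i) w, hP, ?_⟩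
  rw [map_add, map_sub, hP, hP1 u₀ hu₀, map_sub, ← h]
  abel

theorem Matrix.exists_coprime_zpow_eq_pow {ι : Type*} [Fintype ι] [DecidableEq ι]
    (C : Matrix ι ι ℤ) {q : ℤ} {m : ℕ} (hm : 0 < m) (hq : Int.gcd q m = 1)
    (hC : orderOf C = m) : ∃ r : ℕ, r.Coprime m ∧ C ^ q = C ^ r := by
  obtain ⟨U, rfl⟩ := (orderOf_pos_iff.1 (hC ▸ hm)).isUnit
  rw [orderOf_units] at hC
  have hr : ((q % m).toNat : ℤ) = q % m := Int.toNat_of_nonneg (Int.emod_nonneg _ (by omega))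
  refine ⟨(q % m).toNat, ?_, ?_⟩
  · rw [Nat.Coprime, ← Int.gcd_natCast_natCast, hr, Int.gcd_emod, hq]
  · rw [← Matrix.coe_units_zpow, ← Units.val_pow_eq_pow_val, ← zpow_natCast, hr, ← hC,
      zpow_mod_orderOf]

theorem QMat_pow {k : ℕ} (C : Matrix (Fin k) (Fin k) ℤ) (r : ℕ) :
    QMat (C ^ r) = QMat C ^ r :=
  map_pow (Int.castRingHom ℚ).mapMatrix C r

theorem orderOf_toLin'_QMat {k : ℕ} (C : Matrix (Fin k) (Fin k) ℤ) :
    orderOf (Matrix.toLin' (QMat C)) = orderOf C := by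
  rw [← orderOf_injective
    ((Int.castRingHom ℚ).mapMatrix : Matrix (Fin k) (Fin k) ℤ →+* _).toMonoidHom
    (Matrix.map_injective (f := ((↑) : ℤ → ℚ)) Int.cast_injective) C]
  exact orderOf_injective (Matrix.toLinAlgEquiv' : Matrix (Fin k) (Fin k) ℚ ≃ₐ[ℚ] _).toMonoidHom
    Matrix.toLinAlgEquiv'.injective (QMat C)

/-- The rational block matrix `[[1, 0ᵀ],[b, P]]`. -/
def blockOneRat {k : ℕ} (b : Fin k → ℚ) (P : Matrix (Fin k) (Fin k) ℚ) :
    Matrix (Fin (k + 1)) (Fin (k + 1)) ℚ :=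
  Matrix.of (Fin.cons (Fin.cons 1 0) fun i => Fin.cons (b i) (P i))

theorem QMat_blockOne {k : ℕ} (u : Fin k → ℤ) (C : Matrix (Fin k) (Fin k) ℤ) :
    QMat (blockOne u C) = blockOneRat (fun i => u i) (QMat C) := by
  ext i j
  cases i using Fin.cases <;> cases j using Fin.cases <;> simp [QMat, blockOne, blockOneRat]

theorem blockOneRat_mul {k : ℕ} (b c : Fin k → ℚ) (P Q : Matrix (Fin k) (Fin k) ℚ) :
    blockOneRat b P * blockOneRat c Q = blockOneRat (b + P *ᵥ c) (P * Q) := by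
  ext i j
  cases i using Fin.cases <;> cases j using Fin.cases <;>
    simp [blockOneRat, Matrix.mul_apply, Fin.sum_univ_succ, Matrix.mulVec, dotProduct]

theorem det_blockOneRat {k : ℕ} (b : Fin k → ℚ) (P : Matrix (Fin k) (Fin k) ℚ) :
    (blockOneRat b P).det = P.det := by
  rw [Matrix.det_succ_row_zero, Fin.sum_univ_succ]
  simp [blockOneRat, Matrix.submatrix]
  rfl

theorem exists_conj_QMat_blockOne {k m : ℕ} {q : ℤ} (hm : 0 < m) (hq : Int.gcd q m = 1)
    (u : Fin k → ℤ) (C : Matrix (Fin k) (Fin k) ℤ) (hC : orderOf C = m) :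
    ∃ B : Matrix (Fin (k + 1)) (Fin (k + 1)) ℚ, IsUnit B.det ∧
      QMat (blockOne u (C ^ q)) = B * QMat (blockOne u C) * B⁻¹ := by
  obtain ⟨r, hr, hCr⟩ := C.exists_coprime_zpow_eq_pow hm hq hC
  obtain ⟨P, b, hP, hb⟩ := exists_affine_conjugator (Matrix.toLin' (QMat C)) hm hr
    ((orderOf_toLin'_QMat C).trans hC) (fun i => u i)
  rw [← Matrix.toLin'_pow] at hP hb
  have hPC : LinearMap.toMatrix' P.toLinearMap * QMat C =
      QMat C ^ r * LinearMap.toMatrix' P.toLinearMap := by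
    apply Matrix.toLin'.injective
    refine LinearMap.ext fun x => ?_
    simpa [Matrix.toLin'_mul] using hP x
  have hdet : IsUnit (blockOneRat b (LinearMap.toMatrix' P.toLinearMap)).det := by
    rw [det_blockOneRat, LinearMap.det_toMatrix']
    exact P.isUnit_det'
  refine ⟨_, hdet, ?_⟩
  have hcomm : blockOneRat b (LinearMap.toMatrix' P.toLinearMap) * QMat (blockOne u C) =
      QMat (blockOne u (C ^ q)) * blockOneRat b (LinearMap.toMatrix' P.toLinearMap) := by
    rw [hCr, QMat_blockOne, QMat_blockOne, blockOneRat_mul, blockOneRat_mul, QMat_pow, hPC]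
    congr 1
    simpa only [LinearMap.toMatrix'_mulVec, Matrix.toLin'_apply, LinearEquiv.coe_coe] using hb
  rw [hcomm, Matrix.mul_nonsing_inv_cancel_right _ _ hdet]

end

/-- **Lemma.** If `C ∈ GL_{n-1}(ℤ)` has order `m` and `gcd(q,m) = 1`, then the block
matrices `[[1,0ᵀ],[u,C]]` and `[[1,0ᵀ],[u,C^q]]` are conjugate in `GL_n(ℚ)`. -/
theorem block_matrices_conjugate_over_Q
    (q : ℤ) (m n : ℕ) (hm : 0 < m) (hn : 0 < n) (hq : Int.gcd q m = 1)
    (u : Fin (n - 1) → ℤ) (C : Matrix (Fin (n - 1)) (Fin (n - 1)) ℤ)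
    (hC : orderOf C = m) :
    ∃ B : Matrix (Fin n) (Fin n) ℚ, IsUnit B.det ∧
      QMat (Matrix.reindex (finCongr (Nat.succ_pred_eq_of_pos hn))
          (finCongr (Nat.succ_pred_eq_of_pos hn)) (blockOne u (C ^ q))) =
        B * QMat (Matrix.reindex (finCongr (Nat.succ_pred_eq_of_pos hn))
          (finCongr (Nat.succ_pred_eq_of_pos hn)) (blockOne u C)) * B⁻¹ := by
  obtain ⟨k, rfl⟩ := Nat.exists_eq_succ_of_ne_zero hn.ne'
  exact exists_conj_QMat_blockOne hm hq u C hC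
end
end

section
/- There exists a matrix C ∈ GL_36(ℤ) of finite order m = 37 such that, for q = 6 (which satisfies gcd(q,m) = 1), neither the block matrix A = [[1, 0ᵀ],[0, C]] nor its inverse A⁻¹ is conjugate in GL_37(ℤ) to the block matrix Ā = [[1, 0ᵀ],[0, C^q]]. -/
open Matrix

noncomputable section

theorem blockOne_zero_mul {k : ℕ} (X Y : Matrix (Fin k) (Fin k) ℤ) :
    blockOne 0 X * blockOne 0 Y = blockOne 0 (X * Y) := by
  ext i j
  refine Fin.cases ?_ (fun i => ?_) i <;> refine Fin.cases ?_ (fun j => ?_) j <;>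
    simp [blockOne, Matrix.mul_apply, Fin.sum_univ_succ]

theorem blockOne_zero_one {k : ℕ} :
    blockOne (0 : Fin k → ℤ) (1 : Matrix (Fin k) (Fin k) ℤ) = 1 := by
  ext i j
  refine Fin.cases ?_ (fun i => ?_) i <;> refine Fin.cases ?_ (fun j => ?_) j <;>
    simp [blockOne, Matrix.one_apply, Fin.ext_iff]

/-- Conjugacy of `1 ⊕ Y` and `1 ⊕ X` descends to `Y` and `X` when `X` has no nonzero fixed
vector. -/
theorem exists_semiconjBy_of_blockOne_conj {k : ℕ} {X Y : Matrix (Fin k) (Fin k) ℤ}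
    (hX : ∀ v, X *ᵥ v = v → v = 0) {B : Matrix (Fin (k + 1)) (Fin (k + 1)) ℤ}
    (hB : IsUnit B.det) (h : blockOne 0 X = B * blockOne 0 Y * B⁻¹) :
    ∃ D : Matrix (Fin k) (Fin k) ℤ, IsUnit D ∧ SemiconjBy D Y X := by
  have hc : blockOne 0 X * B = B * blockOne 0 Y := by
    rw [h, Matrix.mul_assoc, Matrix.nonsing_inv_mul _ hB, Matrix.mul_one]
  have hcol : (fun i : Fin k => B i.succ 0) = 0 := by
    refine hX _ (funext fun i => ?_)
    have := congrFun (congrFun hc i.succ) 0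
    simpa [blockOne, Matrix.mul_apply, Fin.sum_univ_succ, Matrix.mulVec, dotProduct] using this
  have hcol' (i : Fin k) : B i.succ 0 = 0 := congrFun hcol i
  refine ⟨B.submatrix Fin.succ Fin.succ, IsUnit.of_mul_eq_one (B⁻¹.submatrix Fin.succ Fin.succ) ?_,
    ?_⟩
  · ext i j
    have := congrFun (congrFun (Matrix.mul_nonsing_inv _ hB) i.succ) j.succ
    simpa [Matrix.mul_apply, Fin.sum_univ_succ, hcol', Matrix.one_apply] using this
  · ext i j
    have := congrFun (congrFun hc i.succ) j.succ
    simpa [blockOne, Matrix.mul_apply, Fin.sum_univ_succ] using this.symm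

theorem eq_zero_of_pow_mulVec_eq {k n : ℕ} (hn : n ≠ 0) {X : Matrix (Fin k) (Fin k) ℤ}
    (hX : ∑ i ∈ Finset.range n, X ^ i = 0) {v : Fin k → ℤ} (hv : X *ᵥ v = v) : v = 0 := by
  have hpow (i : ℕ) : (X ^ i) *ᵥ v = v := by
    induction i with
    | zero => simp
    | succ i ih => rw [pow_succ, ← Matrix.mulVec_mulVec, hv, ih]
  have h := congrArg (· *ᵥ v) hX
  simp only [Matrix.sum_mulVec, hpow, Finset.sum_const, Finset.card_range, Matrix.zero_mulVec] at h
  exact (smul_eq_zero.1 h).resolve_left hn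

/-- The value at `z` of the element `∑ fᵢ xⁱ` of `ℤ[x] / (x³⁷ - 1)`. -/
def cyclicEval {R : Type*} [CommRing R] (z : R) (f : ZMod 37 → ℤ) : R :=
  ∑ i, (f i : R) * z ^ i.val

/-- The product in `ℤ[x] / (x³⁷ - 1)`. -/
def cyclicMul (f g : ZMod 37 → ℤ) (k : ZMod 37) : ℤ := ∑ i, f i * g (k - i)

section cyclicEval

variable {R S : Type*} [CommRing R] [CommRing S]

theorem map_cyclicEval (φ : R →+* S) (z : R) (f : ZMod 37 → ℤ) :
    φ (cyclicEval z f) = cyclicEval (φ z) f := by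
  simp [cyclicEval]

theorem cyclicEval_add (z : R) (f g : ZMod 37 → ℤ) :
    cyclicEval z (f + g) = cyclicEval z f + cyclicEval z g := by
  simp [cyclicEval, add_mul, Finset.sum_add_distrib]

theorem pow_val_mul_pow_val {z : R} (hz : z ^ 37 = 1) (i j : ZMod 37) :
    z ^ i.val * z ^ j.val = z ^ (i + j).val := by
  rw [← pow_add, ZMod.val_add, ← pow_eq_pow_mod _ hz]

theorem cyclicEval_mul {z : R} (hz : z ^ 37 = 1) (f g : ZMod 37 → ℤ) :
    cyclicEval z (cyclicMul f g) = cyclicEval z f * cyclicEval z g := by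
  simp only [cyclicEval, cyclicMul, Int.cast_sum, Finset.sum_mul]
  rw [Finset.sum_comm]
  refine Finset.sum_congr rfl fun i _ => ?_
  rw [Finset.mul_sum]
  refine Fintype.sum_equiv (Equiv.subRight i) _ _ fun k => ?_
  rw [mul_mul_mul_comm, pow_val_mul_pow_val hz]
  simp

theorem cyclicEval_pow {z : R} (hz : z ^ 37 = 1) (f : ZMod 37 → ℤ) :
    cyclicEval (z ^ 36) f = cyclicEval z fun i => f (-i) := by
  refine Fintype.sum_equiv (Equiv.neg _) _ _ fun i => ?_
  have h₁ : z ^ i.val * z ^ (-i).val = 1 := by rw [pow_val_mul_pow_val hz]; simp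
  have h₂ : (z ^ 36) ^ i.val * z ^ i.val = 1 := by rw [← mul_pow, ← pow_succ, hz, one_pow]
  simp [left_inv_eq_right_inv h₂ h₁]

theorem cyclicEval_eq {z : R} (hz : ∑ i ∈ Finset.range 37, z ^ i = 0) {f : ZMod 37 → ℤ} {a b : ℤ}
    (hf : ∀ i, f i = b + if i = 0 then a else 0) : cyclicEval z f = a := by
  have : ∑ i : ZMod 37, z ^ i.val = 0 := by
    rw [← hz, Finset.sum_range]; rfl
  simp [cyclicEval, hf, add_mul, Finset.sum_add_distrib, ← Finset.mul_sum, this]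

end cyclicEval

/-- Coefficients of an element of `ℤ[ζ₃₇]` of absolute norm `149 ^ (37 * 18)`: a product of Jacobi
sums of order `37` over `𝔽₁₄₉`. -/
def jacobiCoeff : ZMod 37 → ℤ :=
  ![
    0, -847847591514432968962145720738557866157, 1543124229754332249760652704507366563757,
    -3099864422101437311793310551248948591791, 531606508903868542141144848668865907524,
    -4143241163830827665684524312734685590395, -1860153251844398764493988426717342552419,
    2697378108533776479322325085662514220429, 1942015651567747896027585569510097147117,
    -2612186826759361980653307663767389199333, 1785403502289350734696110499790936719345,
    4367734421479919220972352617859918322513, 557313106991966280037147625817277729986,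
    -2709869676979821518769886285404540989427, 3765843465041399117760382143461397429249,
    1244967589610834627414142185324627996365, -26879456487654313336995418807395288431,
    600669997351962875893082933982737331654, -527479067334010173251686018138854484346,
    922059269247037745609506531286361432353, 3054782364344981470483864772937787317493,
    4701870548157472027130505668035650635425, 2586139042982990964323868993688807039839,
    -3449558147388493792815434993271197835368, -2395625199052975680817161858537746144468,
    -4620335816251101754966758327337578490385, 1674409087683333888444747006051739197859,
    -1417732382325333158757685126275636394313, 1524405277921800923699121273454277614158,
    -4619609694636991238455078315312610311389, -475529561734867155132565357122342000671,
    752734252924903271337088329672717770316, -3491333190055321237989937660314375890259,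
    2747361479544001259064217860392069674744, -2954745088470639693291999900592911385730,
    2120417951336840278883257162346698971068, 3344028679013691733181427096973662808718]

/-- Coefficients of an inverse modulo `149` of the trace to the real subfield of the element with
coefficients `jacobiCoeff`. -/
def traceInvCoeff : ZMod 37 → ℤ :=
  ![
    19, 0, 1, 113, 41, 19, 93, 139, 48, 94, 63, 114, 143, 57, 59, 111, 31, 79, 141, 141, 79, 31,
    111, 59, 57, 143, 114, 63, 94, 48, 139, 93, 19, 41, 113, 1, 0]

theorem cyclicMul_jacobiCoeff (k : ZMod 37) :
    cyclicMul jacobiCoeff (fun i => jacobiCoeff (-i)) k =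
      -6634492572063489901968258888979917892700397709346268738854647841067943546246477 +
        if k = 0 then 149 ^ 37 else 0 := by
  revert k
  decide +kernel

theorem cyclicMul_traceInvCoeff (k : ZMod 37) :
    cyclicMul (jacobiCoeff + fun i => jacobiCoeff (-i)) traceInvCoeff k % 149 =
      (141 + if k = 0 then 1 else 0) % 149 := by
  revert k
  decide +kernel

instance fact_prime_5477 : Fact (Nat.Prime 5477) := ⟨by norm_num⟩

theorem cyclicEval_jacobiCoeff : cyclicEval (4191 : ZMod 5477) jacobiCoeff ^ 592 = 653 := by
  decide +kernel

theorem geom_sum_4191 : ∑ i ∈ Finset.range 37, (4191 : ZMod 5477) ^ i = 0 := by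
  decide +kernel

open NumberField

theorem minpoly_toInteger {K : Type*} [Field K] [NumberField K] {p : ℕ} [Fact p.Prime] {ζ : K}
    (hζ : IsPrimitiveRoot ζ p) :
    minpoly ℤ hζ.toInteger = ∑ i ∈ Finset.range p, Polynomial.X ^ i := by
  rw [← Polynomial.cyclotomic_prime ℤ p,
    Polynomial.cyclotomic_eq_minpoly hζ (Fact.out : p.Prime).pos]
  exact (minpoly.algebraMap_eq RingOfIntegers.coe_injective hζ.toInteger).symm

theorem IsPrimitiveRoot.geom_sum_pow_eq_zero {R : Type*} [CommRing R] [IsDomain R] {n k : ℕ}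
    {ζ : R} (hζ : IsPrimitiveRoot ζ n) (hn : 1 < n) (hk : k.Coprime n) :
    ∑ i ∈ Finset.range n, (ζ ^ k) ^ i = 0 :=
  (hζ.pow_of_coprime k hk).geom_sum_eq_zero hn

section Cyclotomic

variable {K : Type*} [Field K] [NumberField K] {p : ℕ} [Fact p.Prime]
  [IsCyclotomicExtension {p} ℚ K] {ζ : K}

theorem aeval_minpoly_integralPowerBasis_gen {S : Type*} [CommRing S] (hζ : IsPrimitiveRoot ζ p)
    {s : S} (hs : ∑ i ∈ Finset.range p, s ^ i = 0) :
    Polynomial.aeval s (minpoly ℤ hζ.integralPowerBasis.gen) = 0 := by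
  rw [hζ.integralPowerBasis_gen, minpoly_toInteger hζ]
  simpa using hs

/-- The ring homomorphism from the ring of integers of the `p`-th cyclotomic field sending `ζ` to
a given root of the `p`-th cyclotomic polynomial. -/
def cyclotomicLift {S : Type*} [CommRing S] (hζ : IsPrimitiveRoot ζ p) (s : S)
    (hs : ∑ i ∈ Finset.range p, s ^ i = 0) : 𝓞 K →+* S :=
  (hζ.integralPowerBasis.lift s (aeval_minpoly_integralPowerBasis_gen hζ hs) : 𝓞 K →ₐ[ℤ] S)

@[simp]
theorem cyclotomicLift_toInteger {S : Type*} [CommRing S] (hζ : IsPrimitiveRoot ζ p) (s : S)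
    (hs : ∑ i ∈ Finset.range p, s ^ i = 0) : cyclotomicLift hζ s hs hζ.toInteger = s := by
  conv_lhs => rw [← hζ.integralPowerBasis_gen]
  exact hζ.integralPowerBasis.lift_gen s (aeval_minpoly_integralPowerBasis_gen hζ hs)

theorem cyclotomic_ringHom_ext {S : Type*} [CommRing S] (hζ : IsPrimitiveRoot ζ p)
    {f g : 𝓞 K →+* S} (h : f hζ.toInteger = g hζ.toInteger) : f = g := by
  have : f.toIntAlgHom = g.toIntAlgHom := by
    refine hζ.integralPowerBasis.algHom_ext ?_
    rw [hζ.integralPowerBasis_gen]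
    exact h
  ext x
  exact DFunLike.congr_fun this x

/-- Complex conjugation on the ring of integers of the `p`-th cyclotomic field. -/
def cyclotomicConj (hζ : IsPrimitiveRoot ζ p) : 𝓞 K →+* 𝓞 K :=
  cyclotomicLift hζ (hζ.toInteger ^ (p - 1)) (by
    have hp : 1 < p := (Fact.out : p.Prime).one_lt
    exact hζ.toInteger_isPrimitiveRoot.geom_sum_pow_eq_zero hp
      ((Nat.coprime_self_sub_left hp.le).2 (Nat.coprime_one_left p)))

@[simp]
theorem cyclotomicConj_toInteger (hζ : IsPrimitiveRoot ζ p) :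
    cyclotomicConj hζ hζ.toInteger = hζ.toInteger ^ (p - 1) :=
  cyclotomicLift_toInteger ..

theorem cyclotomicConj_involutive (hζ : IsPrimitiveRoot ζ p) :
    Function.Involutive (cyclotomicConj hζ) := by
  have hp : 1 ≤ p := (Fact.out : p.Prime).one_lt.le
  have : (cyclotomicConj hζ).comp (cyclotomicConj hζ) = RingHom.id _ := by
    refine cyclotomic_ringHom_ext hζ ?_
    have h1 := hζ.toInteger_isPrimitiveRoot.pow_eq_one
    obtain ⟨n, rfl⟩ := Nat.exists_eq_add_of_le' hp
    simp only [RingHom.comp_apply, cyclotomicConj_toInteger, map_pow, RingHom.id_apply,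
      Nat.add_sub_cancel]
    have h2 : (hζ.toInteger ^ n) ^ n * hζ.toInteger ^ n = 1 := by
      rw [← pow_succ, ← pow_mul, mul_comm, pow_mul, h1, one_pow]
    have h3 : hζ.toInteger ^ n * hζ.toInteger = 1 := by rw [← pow_succ, h1]
    exact left_inv_eq_right_inv h2 h3
  exact fun x => DFunLike.congr_fun this x

theorem norm_cyclotomicConj (hζ : IsPrimitiveRoot ζ p) (φ : K →+* ℂ) (x : 𝓞 K) :
    ‖φ (cyclotomicConj hζ x : 𝓞 K)‖ = ‖φ x‖ := by
  have hp : 1 ≤ p := (Fact.out : p.Prime).one_lt.le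
  have : (φ.comp (algebraMap (𝓞 K) K)).comp (cyclotomicConj hζ) =
      (starRingEnd ℂ).comp (φ.comp (algebraMap (𝓞 K) K)) := by
    refine cyclotomic_ringHom_ext hζ ?_
    have h1 : φ ζ ^ p = 1 := by rw [← map_pow, hζ.pow_eq_one, map_one]
    have h2 : ‖φ ζ‖ = 1 := Complex.norm_eq_one_of_pow_eq_one h1 (by omega)
    have h3 : φ ζ ^ (p - 1) * φ ζ = 1 := by rw [← pow_succ, Nat.sub_add_cancel hp, h1]
    have h4 : φ ζ * (starRingEnd ℂ) (φ ζ) = 1 := by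
      rw [Complex.mul_conj, Complex.normSq_eq_norm_sq, h2]; simp
    simpa using! left_inv_eq_right_inv h3 h4
  have h := DFunLike.congr_fun this x
  simp only [RingHom.comp_apply] at h
  rw [h, RCLike.norm_conj]

/-- A unit and its complex conjugate differ by a root of unity. -/
theorem unit_pow_eq_cyclotomicConj_pow (hodd : Odd p) (hζ : IsPrimitiveRoot ζ p) (u : (𝓞 K)ˣ) :
    (u : 𝓞 K) ^ (2 * p) = cyclotomicConj hζ u ^ (2 * p) := by
  set v : (𝓞 K)ˣ := u * (Units.map (cyclotomicConj hζ : 𝓞 K →* 𝓞 K) u)⁻¹ with hv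
  have huv : (u : 𝓞 K) = v * cyclotomicConj hζ u := by
    have : u = v * Units.map (cyclotomicConj hζ : 𝓞 K →* 𝓞 K) u := by simp [hv]
    exact congrArg Units.val this
  have hnorm (φ : K →+* ℂ) : ‖φ (v : 𝓞 K)‖ = 1 := by
    have h := congrArg (fun x : 𝓞 K => ‖φ x‖) huv
    simp only [map_mul, norm_mul, norm_cyclotomicConj] at h
    refine (mul_eq_right₀ ?_).1 h.symm
    simp
  obtain ⟨n, hn, hvn⟩ := Embeddings.pow_eq_one_of_norm_eq_one K ℂ (v : 𝓞 K).isIntegral_coe hnorm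
  obtain ⟨r, hr⟩ := hζ.exists_neg_pow_of_isOfFinOrder hodd
    (isOfFinOrder_iff_pow_eq_one.2 ⟨n, hn, hvn⟩)
  have hv1 : (v : 𝓞 K) ^ (2 * p) = 1 := by
    refine RingOfIntegers.coe_injective ?_
    rw [map_pow, map_one, hr, pow_right_comm, pow_mul, neg_sq, pow_right_comm ζ 2 p, hζ.pow_eq_one,
      one_pow, one_pow]
  conv_lhs => rw [huv, mul_pow, hv1, one_mul]

/-- A bijection of an ideal `I` that is semilinear for complex conjugation makes `I` and its
conjugate equivalent in the class group. -/
theorem exists_span_mul_eq_of_semilinear (hζ : IsPrimitiveRoot ζ p) {I : Ideal (𝓞 K)} (hI : I ≠ ⊥)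
    (g : I ≃ₗ[ℤ] I) (hg : ∀ x, g (hζ.toInteger • x) = hζ.toInteger ^ (p - 1) • g x) :
    ∃ a b : 𝓞 K, a ≠ 0 ∧ b ≠ 0 ∧
      Ideal.span {a} * I = Ideal.span {b} * I.map (cyclotomicConj hζ) := by
  have hsemi (c : 𝓞 K) (x : I) : g (c • x) = cyclotomicConj hζ c • g x := by
    have hc : c ∈ Algebra.adjoin ℤ {hζ.toInteger} := by
      rw [← hζ.integralPowerBasis_gen, hζ.integralPowerBasis.adjoin_gen_eq_top]
      trivial
    induction hc using Algebra.adjoin_induction generalizing x with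
    | mem c hc =>
      rw [Set.mem_singleton_iff] at hc
      rw [hc, hg, cyclotomicConj_toInteger]
    | algebraMap r => simp [Int.cast_smul_eq_zsmul]
    | add c d _ _ hc hd => rw [add_smul, map_add, hc, hd, map_add, add_smul]
    | mul c d _ _ hc hd => rw [mul_smul, hc, hd, map_mul, mul_smul]
  obtain ⟨x₀, hx₀, hx₀'⟩ := Submodule.exists_mem_ne_zero_of_ne_bot hI
  have hswap (x : I) : cyclotomicConj hζ x₀ * (g x : 𝓞 K) =
      g ⟨x₀, hx₀⟩ * cyclotomicConj hζ x := by
    have h : x₀ • x = (x : 𝓞 K) • (⟨x₀, hx₀⟩ : I) := Subtype.ext (mul_comm _ _)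
    have := congrArg (fun y : I => (y : 𝓞 K)) (congrArg g h)
    simp only [hsemi] at this
    rw [mul_comm (g _ : 𝓞 K)]
    exact this
  refine ⟨cyclotomicConj hζ x₀, g ⟨x₀, hx₀⟩, ?_, ?_, le_antisymm ?_ ?_⟩
  · rwa [Ne, map_eq_zero_iff _ (cyclotomicConj_involutive hζ).injective]
  · simpa using hx₀'
  · rw [Ideal.span_singleton_mul_le_iff]
    intro y hy
    obtain ⟨x, hx⟩ := g.surjective ⟨y, hy⟩
    have := hswap x
    rw [hx] at this
    rw [this]
    exact Ideal.mul_mem_mul (Ideal.mem_span_singleton_self _) (Ideal.mem_map_of_mem _ x.2)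
  · rw [Ideal.map, Ideal.span_mul_span', Ideal.span_le]
    rintro _ ⟨_, rfl, _, ⟨x, hx, rfl⟩, rfl⟩
    simp only [SetLike.mem_coe]
    rw [← hswap ⟨x, hx⟩]
    exact Ideal.mul_mem_mul (Ideal.mem_span_singleton_self _) (g ⟨x, hx⟩).2

end Cyclotomic

section ThirtySeven

instance fact_prime_37 : Fact (Nat.Prime 37) := ⟨by norm_num⟩

variable {K : Type*} [Field K] [NumberField K] [IsCyclotomicExtension {37} ℚ K] {ζ : K}

/-- The product of Jacobi sums with coefficients `jacobiCoeff`. -/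
def jacobiProd (hζ : IsPrimitiveRoot ζ 37) : 𝓞 K := cyclicEval hζ.toInteger jacobiCoeff

theorem conj_jacobiProd (hζ : IsPrimitiveRoot ζ 37) :
    cyclotomicConj hζ (jacobiProd hζ) = cyclicEval hζ.toInteger fun i => jacobiCoeff (-i) := by
  rw [jacobiProd, map_cyclicEval, cyclotomicConj_toInteger,
    cyclicEval_pow hζ.toInteger_isPrimitiveRoot.pow_eq_one]

theorem jacobiProd_mul_conj (hζ : IsPrimitiveRoot ζ 37) :
    jacobiProd hζ * cyclotomicConj hζ (jacobiProd hζ) = 149 ^ 37 := by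
  have h := hζ.toInteger_isPrimitiveRoot
  rw [conj_jacobiProd, jacobiProd, ← cyclicEval_mul h.pow_eq_one,
    cyclicEval_eq (h.geom_sum_eq_zero (by norm_num)) cyclicMul_jacobiCoeff]
  norm_num

theorem isCoprime_jacobiProd_conj (hζ : IsPrimitiveRoot ζ 37) :
    IsCoprime (jacobiProd hζ) (cyclotomicConj hζ (jacobiProd hζ)) := by
  have h := hζ.toInteger_isPrimitiveRoot
  have hdvd (k : ZMod 37) := Int.modEq_iff_dvd.1 (cyclicMul_traceInvCoeff k).symm
  choose v hv using hdvd
  set t := jacobiProd hζ + cyclotomicConj hζ (jacobiProd hζ) with ht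
  set w := cyclicEval hζ.toInteger traceInvCoeff
  have hval : t * w - 149 * cyclicEval hζ.toInteger v = 1 := by
    have h1 : cyclicEval hζ.toInteger (cyclicMul
        (jacobiCoeff + fun i => jacobiCoeff (-i)) traceInvCoeff) = t * w := by
      rw [cyclicEval_mul h.pow_eq_one, cyclicEval_add, ht, conj_jacobiProd, jacobiProd]
    have h2 : cyclicEval hζ.toInteger (fun k => cyclicMul
        (jacobiCoeff + fun i => jacobiCoeff (-i)) traceInvCoeff k - 149 * v k) = 1 := by
      have := cyclicEval_eq (R := 𝓞 K) (z := hζ.toInteger) (h.geom_sum_eq_zero (by norm_num))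
        (a := 1) (b := 141)
        (f := fun k => cyclicMul (jacobiCoeff + fun i => jacobiCoeff (-i)) traceInvCoeff k -
          149 * v k) (fun k => by rw [← hv k, sub_sub_cancel])
      simpa using this
    rw [← h1, ← h2]
    simp [cyclicEval, sub_mul, Finset.sum_sub_distrib, Finset.mul_sum, mul_assoc]
  have hcop : IsCoprime t 149 := ⟨w, -cyclicEval hζ.toInteger v, by linear_combination hval⟩
  have hmul : IsCoprime t (jacobiProd hζ * cyclotomicConj hζ (jacobiProd hζ)) := by
    rw [jacobiProd_mul_conj]
    exact hcop.pow_right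
  have := hmul.of_mul_right_left.symm
  rw [ht] at this
  exact (IsCoprime.add_mul_left_right_iff (z := 1)).1 (by simpa [add_comm] using this)

theorem exists_ideal_pow_eq_span_jacobiProd (hζ : IsPrimitiveRoot ζ 37) :
    ∃ I : Ideal (𝓞 K), Ideal.span {jacobiProd hζ} = I ^ 37 := by
  have hmul : Ideal.span {jacobiProd hζ} * Ideal.span {cyclotomicConj hζ (jacobiProd hζ)} =
      Ideal.span {(149 : 𝓞 K)} ^ 37 := by
    rw [Ideal.span_singleton_mul_span_singleton, jacobiProd_mul_conj, Ideal.span_singleton_pow]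
  refine exists_eq_pow_of_mul_eq_pow_of_coprime ?_ hmul
  exact (Ideal.isCoprime_span_singleton_iff _ _).2 (isCoprime_jacobiProd_conj hζ)

theorem jacobiProd_ne_zero (hζ : IsPrimitiveRoot ζ 37) : jacobiProd hζ ≠ 0 := by
  intro h
  have := jacobiProd_mul_conj hζ
  rw [h, zero_mul] at this
  exact pow_ne_zero 37 (by norm_num) this.symm

theorem ne_bot_of_pow_eq_span_jacobiProd (hζ : IsPrimitiveRoot ζ 37) {I : Ideal (𝓞 K)}
    (hI : Ideal.span {jacobiProd hζ} = I ^ 37) : I ≠ ⊥ := by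
  rintro rfl
  rw [← Ideal.zero_eq_bot, zero_pow (by norm_num), Ideal.zero_eq_bot,
    Ideal.span_singleton_eq_bot] at hI
  exact jacobiProd_ne_zero hζ hI

/-- The power residue symbol of `jacobiProd` at a prime above `5477` is nontrivial. -/
theorem jacobiProd_pow_ne_pow (hζ : IsPrimitiveRoot ζ 37) (r : 𝓞 K) :
    jacobiProd hζ ^ 592 ≠ r ^ 5476 := by
  intro h
  have h := congrArg (cyclotomicLift hζ (4191 : ZMod 5477) geom_sum_4191) h
  rw [map_pow, map_pow, jacobiProd, map_cyclicEval, cyclotomicLift_toInteger,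
    cyclicEval_jacobiCoeff] at h
  by_cases hr : cyclotomicLift hζ (4191 : ZMod 5477) geom_sum_4191 r = 0
  · rw [hr, zero_pow (by norm_num)] at h
    revert h
    decide +kernel
  · rw [ZMod.pow_card_sub_one_eq_one hr] at h
    revert h
    decide +kernel

/-- A `37`th root of `(jacobiProd)` is not equivalent to its complex conjugate in the class
group. -/
theorem not_semilinear_of_pow_eq_span_jacobiProd (hζ : IsPrimitiveRoot ζ 37) {I : Ideal (𝓞 K)}
    (hI : Ideal.span {jacobiProd hζ} = I ^ 37) (g : I ≃ₗ[ℤ] I)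
    (hg : ∀ x, g (hζ.toInteger • x) = hζ.toInteger ^ 36 • g x) : False := by
  have hI0 := ne_bot_of_pow_eq_span_jacobiProd hζ hI
  obtain ⟨a, b, ha, hb, hab⟩ := exists_span_mul_eq_of_semilinear hζ hI0 g hg
  have hpow := congrArg (· ^ 37) hab
  simp only [mul_pow, ← Ideal.map_pow, ← hI, Ideal.map_span, Set.image_singleton,
    Ideal.span_singleton_pow, Ideal.span_singleton_mul_span_singleton,
    Ideal.span_singleton_eq_span_singleton] at hpow
  obtain ⟨u, hu⟩ := hpow
  have hN := jacobiProd_mul_conj hζ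
  have hu' := congrArg (cyclotomicConj hζ) hu
  simp only [map_mul, map_pow, cyclotomicConj_involutive hζ _] at hu'
  have htors := unit_pow_eq_cyclotomicConj_pow (by decide) hζ u
  have hinj := (cyclotomicConj_involutive hζ).injective
  have ha' : cyclotomicConj hζ a ≠ 0 := by rwa [Ne, map_eq_zero_iff _ hinj]
  have hb' : cyclotomicConj hζ b ≠ 0 := by rwa [Ne, map_eq_zero_iff _ hinj]
  have hu0 : (u : 𝓞 K) ≠ 0 := u.ne_zero
  have huσ : IsUnit (cyclotomicConj hζ u) := u.isUnit.map _
  set σ := cyclotomicConj hζ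
  set γ := jacobiProd hζ
  have key : (149 ^ 2 * (b * σ a)) ^ 37 * σ u = (a * σ b) ^ 37 * (γ ^ 4 * u) := by
    calc (149 ^ 2 * (b * σ a)) ^ 37 * σ u = (149 ^ 37) ^ 2 * (b ^ 37 * (σ a ^ 37 * σ u)) := by ring
      _ = γ ^ 2 * (b ^ 37 * σ γ) * (σ a ^ 37 * σ γ * σ u) := by rw [← hN]; ring
      _ = (a * σ b) ^ 37 * (γ ^ 4 * u) := by rw [← hu, hu']; ring
  have hdvd : a * σ b ∣ 149 ^ 2 * (b * σ a) := by
    rw [← IsIntegrallyClosed.pow_dvd_pow_iff (n := 37) (by norm_num), ← huσ.dvd_mul_right, key]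
    exact dvd_mul_right _ _
  obtain ⟨r, hr⟩ := hdvd
  rw [hr, mul_pow, mul_assoc] at key
  have key' := mul_left_cancel₀ (pow_ne_zero 37 (mul_ne_zero ha hb')) key
  have h148 : γ ^ 592 * (u : 𝓞 K) ^ 148 = r ^ 5476 * (u : 𝓞 K) ^ 148 := by
    have h1 : (u : 𝓞 K) ^ 148 = σ u ^ 148 := by
      have := congrArg (· ^ 2) htors
      simpa only [← pow_mul] using this
    calc γ ^ 592 * (u : 𝓞 K) ^ 148 = (γ ^ 4 * u) ^ 148 := by ring
      _ = (r ^ 37 * σ u) ^ 148 := by rw [key']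
      _ = r ^ 5476 * (u : 𝓞 K) ^ 148 := by rw [h1]; ring
  exact jacobiProd_pow_ne_pow hζ r (mul_right_cancel₀ (pow_ne_zero 148 hu0) h148)

/-- The integral matrix representation of a ring on an ideal with a given `ℤ`-basis. -/
def idealMatrixRep {R ι : Type*} [CommRing R] [Fintype ι] [DecidableEq ι] {I : Ideal R}
    (b : Module.Basis ι ℤ I) : R →ₐ[ℤ] Matrix ι ι ℤ :=
  (LinearMap.toMatrixAlgEquiv b).toAlgHom.comp (Algebra.lsmul ℤ ℤ I)

theorem idealMatrixRep_injective {R ι : Type*} [CommRing R] [IsDomain R] [Fintype ι]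
    [DecidableEq ι] {I : Ideal R} (hI : I ≠ ⊥) (b : Module.Basis ι ℤ I) :
    Function.Injective (idealMatrixRep b) := by
  refine (LinearMap.toMatrixAlgEquiv b).injective.comp fun x y h => ?_
  obtain ⟨z, hz, hz'⟩ := Submodule.exists_mem_ne_zero_of_ne_bot hI
  have := congrArg (fun w : I => (w : R)) (LinearMap.congr_fun h ⟨z, hz⟩)
  exact mul_right_cancel₀ hz' this

theorem not_semiconjBy_idealMatrixRep (hζ : IsPrimitiveRoot ζ 37) {I : Ideal (𝓞 K)}
    (hI : Ideal.span {jacobiProd hζ} = I ^ 37) {ι : Type*} [Fintype ι] [DecidableEq ι]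
    (b : Module.Basis ι ℤ I) {D : Matrix ι ι ℤ} (hD : IsUnit D) :
    ¬ SemiconjBy D (idealMatrixRep b hζ.toInteger) (idealMatrixRep b hζ.toInteger ^ 36) := by
  intro h
  have hunit : IsUnit ((LinearMap.toMatrixAlgEquiv b).symm D) := hD.map _
  rw [← map_pow] at h
  have h' := h.map (LinearMap.toMatrixAlgEquiv b).symm
  have hsymm (x : 𝓞 K) : (LinearMap.toMatrixAlgEquiv b).symm (idealMatrixRep b x) =
      Algebra.lsmul ℤ ℤ I x := AlgEquiv.symm_apply_apply _ _
  rw [hsymm, hsymm] at h'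
  refine not_semilinear_of_pow_eq_span_jacobiProd hζ hI
    (LinearEquiv.ofBijective _ ((Module.End.isUnit_iff _).1 hunit)) fun x => ?_
  exact LinearMap.congr_fun h' x

end ThirtySeven

/-- **Example.** There is a matrix `C ∈ GL_36(ℤ)` of order `37` such that for `q = 6`
(`gcd(6,37) = 1`), neither `A = [[1,0ᵀ],[0,C]]` nor `A⁻¹` is conjugate in `GL_37(ℤ)` to
`Ā = [[1,0ᵀ],[0,C^6]]`. -/
theorem exists_block_not_conjugate :
    ∃ C : Matrix (Fin 36) (Fin 36) ℤ, orderOf C = 37 ∧ Nat.gcd 6 37 = 1 ∧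
      (¬∃ B : Matrix (Fin 37) (Fin 37) ℤ, IsUnit B.det ∧
        blockOne (0 : Fin 36 → ℤ) (C ^ 6) = B * blockOne (0 : Fin 36 → ℤ) C * B⁻¹) ∧
      (¬∃ B : Matrix (Fin 37) (Fin 37) ℤ, IsUnit B.det ∧
        blockOne (0 : Fin 36 → ℤ) (C ^ 6) =
          B * (blockOne (0 : Fin 36 → ℤ) C)⁻¹ * B⁻¹) := by
  have : NeZero ((37 : ℕ) : ℚ) := ⟨by norm_num⟩
  have : @IsCyclotomicExtension {37} ℚ (CyclotomicField 37 ℚ) _ _ DivisionRing.toRatAlgebra := by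
    convert! CyclotomicField.isCyclotomicExtension 37 ℚ
  have hζ := IsCyclotomicExtension.zeta_spec 37 ℚ (CyclotomicField 37 ℚ)
  have hζ' := hζ.toInteger_isPrimitiveRoot
  obtain ⟨I, hI⟩ := exists_ideal_pow_eq_span_jacobiProd hζ
  have hI0 := ne_bot_of_pow_eq_span_jacobiProd hζ hI
  have hdim : hζ.integralPowerBasis.dim = 36 := by
    rw [hζ.integralPowerBasis_dim, Nat.totient_prime (by norm_num)]
  let b := Ideal.selfBasis (hζ.integralPowerBasis.basis.reindex (finCongr hdim)) I hI0
  set C := idealMatrixRep b hζ.toInteger with hC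
  have horder : orderOf C = 37 :=
    (orderOf_injective (idealMatrixRep b).toMonoidHom (idealMatrixRep_injective hI0 b) _).trans
      hζ'.eq_orderOf.symm
  have hC37 : C ^ 37 = 1 := horder ▸ pow_orderOf_eq_one C
  have hmod {m n : ℕ} (h : m % 37 = n % 37) : C ^ m = C ^ n := by
    rw [pow_eq_pow_mod m hC37, h, ← pow_eq_pow_mod n hC37]
  have hfix (v) (hv : (C ^ 6) *ᵥ v = v) : v = 0 := by
    refine eq_zero_of_pow_mulVec_eq (n := 37) (by norm_num) ?_ hv
    have := congrArg (idealMatrixRep b)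
      (hζ'.geom_sum_pow_eq_zero (k := 6) (by norm_num) (by norm_num))
    simpa [hC] using this
  have hinv : (blockOne (0 : Fin 36 → ℤ) C)⁻¹ = blockOne 0 (C ^ 36) := by
    refine Matrix.inv_eq_right_inv ?_
    rw [blockOne_zero_mul, ← pow_succ', hC37, blockOne_zero_one]
  refine ⟨C, horder, by norm_num, ?_, ?_⟩
  · rintro ⟨B, hB, h⟩
    obtain ⟨D, hD, hDC⟩ := exists_semiconjBy_of_blockOne_conj hfix hB h
    refine not_semiconjBy_idealMatrixRep hζ hI b (hD.mul hD) ?_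
    have h2 := hDC.pow_right 6
    rw [← pow_mul] at h2
    exact h2.mul_left hDC
  · rintro ⟨B, hB, h⟩
    rw [hinv] at h
    obtain ⟨D, hD, hDC⟩ := exists_semiconjBy_of_blockOne_conj hfix hB h
    refine not_semiconjBy_idealMatrixRep hζ hI b (hD.mul hD) ?_
    have h1 := hDC.pow_right 36
    have h2 := hDC.pow_right 6
    rw [← pow_mul, ← pow_mul, hmod (n := 1) (by norm_num), pow_one] at h1
    rw [← pow_mul, ← pow_mul] at h2
    exact h2.mul_left h1
end
end
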